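/- arXiv:2011.04686 — 3 statements merged into one kernel-verified Lean document; each statement's English description precedes it below -/
import Mathlib

section
/- Episode-count lemma: Let T ≥ 1 and η ≥ 0 be integers, and let T_1, …, T_K be positive integers with the convention T_0 = 0. Suppose (i) T_k ≤ T_{k−1} + 1 for every k ∈ {1, …, K}; (ii) Σ_{k=1}^K T_k ≤ T; and (iii) the number of indices k ∈ {1, …, K} with T_k < T_{k−1} + 1 is at most η. Then K ≤ sqrt(2 (η + 1) T). -/
open Finset

lemma episode_aux (Tlen : ℕ → ℕ) (l : ℝ) (K : ℕ)
    (hpos : ∀ k ∈ Finset.Icc 1 K, 0 < Tlen k) :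
    ∃ m : ℕ, m ≤ Tlen K ∧
      2 * l * ((K : ℝ) - m)
        - (((Finset.Icc 1 K).filter fun k => Tlen k < Tlen (k - 1) + 1).card : ℝ) * l ^ 2
        + m * (m + 1) ≤ 2 * ((∑ k ∈ Finset.Icc 1 K, Tlen k : ℕ) : ℝ) := by
  induction K with
  | zero => exact ⟨0, Nat.zero_le _, by simp⟩
  | succ n ih =>
    obtain ⟨m, hm, h⟩ := ih (fun k hk => hpos k (by
      simp only [Finset.mem_Icc] at hk ⊢; omega))
    have hp := hpos (n + 1) (by simp)
    have hI : Finset.Icc 1 (n + 1) = insert (n + 1) (Finset.Icc 1 n) := by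
      ext x; simp only [Finset.mem_Icc, Finset.mem_insert]; omega
    have hn : n + 1 ∉ Finset.Icc 1 n := by simp
    rw [hI, Finset.sum_insert hn, Finset.filter_insert]
    by_cases hd : Tlen (n + 1) < Tlen (n + 1 - 1) + 1
    · rw [if_pos hd, Finset.card_insert_of_notMem (by simp)]
      refine ⟨1, hp, ?_⟩
      have hp' : (1 : ℝ) ≤ Tlen (n + 1) := by exact_mod_cast hp
      have hm0 : (0 : ℝ) ≤ m := Nat.cast_nonneg m
      push_cast at h ⊢
      nlinarith [sq_nonneg ((m : ℝ) - l)]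
    · rw [if_neg hd]
      have h1 : m + 1 ≤ Tlen (n + 1) := by
        simp only [Nat.add_sub_cancel] at hd; omega
      refine ⟨m + 1, h1, ?_⟩
      have h1' : (m : ℝ) + 1 ≤ Tlen (n + 1) := by exact_mod_cast h1
      push_cast at h ⊢
      nlinarith

/-- Episode-count lemma: if the positive episode lengths `T_k` grow by at most one, sum to
at most `T`, and strictly fewer-than-maximal growth happens on at most `η` episodes, then
the number of episodes satisfies `K ≤ sqrt (2 (η + 1) T)`. -/
theorem episode_count_lemma
    (T η K : ℕ) (hT : 1 ≤ T)
    (Tlen : ℕ → ℕ) (hT0 : Tlen 0 = 0)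
    (hpos : ∀ k ∈ Finset.Icc 1 K, 0 < Tlen k)
    (hgrow : ∀ k ∈ Finset.Icc 1 K, Tlen k ≤ Tlen (k - 1) + 1)
    (hsum : ∑ k ∈ Finset.Icc 1 K, Tlen k ≤ T)
    (hcount : ((Finset.Icc 1 K).filter fun k => Tlen k < Tlen (k - 1) + 1).card ≤ η) :
    (K : ℝ) ≤ Real.sqrt (2 * (η + 1) * T) := by
  apply Real.le_sqrt_of_sq_le
  have he : (0 : ℝ) < (η : ℝ) + 1 := by positivity
  obtain ⟨l, hl⟩ : ∃ l : ℝ, l * ((η : ℝ) + 1) = K := ⟨K / (η + 1), by field_simp⟩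
  obtain ⟨m, -, h⟩ := episode_aux Tlen l K hpos
  have hs : ((∑ k ∈ Finset.Icc 1 K, Tlen k : ℕ) : ℝ) ≤ T := by exact_mod_cast hsum
  have hc : (((Finset.Icc 1 K).filter fun k => Tlen k < Tlen (k - 1) + 1).card : ℝ) ≤ η := by
    exact_mod_cast hcount
  have hm0 : (0 : ℝ) ≤ m := Nat.cast_nonneg m
  have hc' := mul_le_mul_of_nonneg_right hc (sq_nonneg l)
  have key : 2 * l * K - ((η : ℝ) + 1) * l ^ 2 ≤ 2 * T := by
    nlinarith [sq_nonneg ((m : ℝ) - l)]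
  have e : 2 * l * K - ((η : ℝ) + 1) * l ^ 2 = l * K := by
    rw [← hl]; ring
  rw [e] at key
  have := mul_le_mul_of_nonneg_left key he.le
  calc (K : ℝ) ^ 2 = ((η : ℝ) + 1) * (l * K) := by rw [← hl]; ring
    _ ≤ _ := this
    _ = _ := by ring
end

section
/- Bounding the number of determinant halvings: Let d ≥ 1, σ > 0, λ_min > 0. Let M₁ be a symmetric positive definite d × d real matrix whose smallest eigenvalue is at least λ_min, let z_1, …, z_{T−1} ∈ R^d, and set M_T = M₁ + σ^{−2} Σ_{t=1}^{T−1} z_t z_tᵀ. If η ≥ 1 is an integer with det(M_T) ≥ 2^{η−1} det(M₁), then η ≤ 1 + (d / log 2) · log( ( tr(M₁) + σ^{−2} Σ_{t=1}^{T−1} ‖z_t‖² ) / (d λ_min) ). -/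
open Matrix Finset

lemma aux_logdet_le {d : ℕ} (hd : 1 ≤ d) (A : Matrix (Fin d) (Fin d) ℝ) (hA : A.PosDef) :
    0 < A.trace ∧ Real.log A.det ≤ d * Real.log (A.trace / d) := by
  have hpos := hA.eigenvalues_pos
  have hdet := hA.isHermitian.det_eq_prod_eigenvalues
  have htr := hA.isHermitian.trace_eq_sum_eigenvalues
  simp only [RCLike.ofReal_real_eq_id, id] at hdet htr
  generalize hA.isHermitian.eigenvalues = l at *
  have hd0 : (0 : ℝ) < d := by exact_mod_cast hd
  have htp : 0 < A.trace := by
    rw [htr]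
    exact Finset.sum_pos (fun i _ => hpos i) ⟨⟨0, hd⟩, Finset.mem_univ _⟩
  refine ⟨htp, ?_⟩
  have hc : 0 < A.trace / d := by positivity
  set c := A.trace / d with hcdef
  have hs : ∑ i, l i = c * d := by rw [← htr, hcdef]; field_simp
  rw [hdet, Real.log_prod (fun i _ => (hpos i).ne')]
  have key : ∀ i ∈ Finset.univ, Real.log (l i) ≤ Real.log c + (l i / c - 1) := by
    intro i _
    have := Real.log_le_sub_one_of_pos (div_pos (hpos i) hc)
    rw [Real.log_div (hpos i).ne' hc.ne'] at this
    linarith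
  refine (Finset.sum_le_sum key).trans ?_
  rw [Finset.sum_add_distrib, Finset.sum_sub_distrib, ← Finset.sum_div, hs]
  simp
  field_simp
  simp

lemma aux_logdet_ge {d : ℕ} (lam : ℝ) (hlam : 0 < lam) (A : Matrix (Fin d) (Fin d) ℝ)
    (hA : A.PosDef) (hev : ∀ x : Fin d → ℝ, lam * (x ⬝ᵥ x) ≤ x ⬝ᵥ A.mulVec x) :
    d * Real.log lam ≤ Real.log A.det := by
  have hpos := hA.eigenvalues_pos
  have hdet := hA.isHermitian.det_eq_prod_eigenvalues
  simp only [RCLike.ofReal_real_eq_id, id] at hdet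
  have hle : ∀ i, lam ≤ hA.isHermitian.eigenvalues i := by
    intro i
    have h1 := hev (hA.isHermitian.eigenvectorBasis i).ofLp
    rw [hA.isHermitian.mulVec_eigenvectorBasis i, dotProduct_smul, smul_eq_mul] at h1
    refine le_of_mul_le_mul_right h1 ?_
    have hn := (hA.isHermitian.eigenvectorBasis).orthonormal.1 i
    have : (hA.isHermitian.eigenvectorBasis i).ofLp ⬝ᵥ (hA.isHermitian.eigenvectorBasis i).ofLp
        = ‖hA.isHermitian.eigenvectorBasis i‖ ^ 2 := by
      rw [EuclideanSpace.real_norm_sq_eq]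
      simp [dotProduct, sq]
    rw [this, hn]; norm_num
  rw [hdet, Real.log_prod (fun i _ => (hpos i).ne')]
  have := Finset.sum_le_sum (s := Finset.univ) fun i _ => Real.log_le_log hlam (hle i)
  simpa using this

/-- Bounding the number of determinant halvings: if the inverse posterior covariance evolves
by rank-one updates and its determinant grows by a factor `2^{η-1}` over the horizon, then
`η ≤ 1 + (d / log 2) log((tr M₁ + σ⁻² Σ ‖z_t‖²) / (d λ_min))`. -/
theorem determinant_halvings_bound
    (d : ℕ) (hd : 1 ≤ d) (σ lammin : ℝ) (hσ : 0 < σ) (hlam : 0 < lammin)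
    (T : ℕ) (hT : 1 ≤ T)
    (M₁ : Matrix (Fin d) (Fin d) ℝ) (hM₁sym : M₁.IsSymm) (hM₁pd : M₁.PosDef)
    (hev : ∀ x : Fin d → ℝ, lammin * (x ⬝ᵥ x) ≤ x ⬝ᵥ M₁.mulVec x)
    (z : ℕ → (Fin d → ℝ))
    (MT : Matrix (Fin d) (Fin d) ℝ)
    (hMT : MT = M₁ + (σ ^ 2)⁻¹ •
      ∑ t ∈ Finset.Icc 1 (T - 1), Matrix.vecMulVec (z t) (z t))
    (η : ℕ) (hη : 1 ≤ η)
    (hdet : (2 : ℝ) ^ (η - 1) * M₁.det ≤ MT.det) :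
    (η : ℝ) ≤ 1 + ((d : ℝ) / Real.log 2) *
      Real.log ((M₁.trace + (σ ^ 2)⁻¹ * ∑ t ∈ Finset.Icc 1 (T - 1), z t ⬝ᵥ z t)
        / (d * lammin)) := by
  have hd0 : (0 : ℝ) < d := by exact_mod_cast hd
  have hPS : ((σ ^ 2)⁻¹ • ∑ t ∈ Finset.Icc 1 (T - 1), Matrix.vecMulVec (z t) (z t)).PosSemidef := by
    refine Matrix.PosSemidef.smul ?_ (by positivity)
    refine Matrix.posSemidef_sum _ fun t _ => ?_
    simpa using Matrix.posSemidef_vecMulVec_self_star (z t)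
  have hMTpd : MT.PosDef := hMT ▸ hM₁pd.add_posSemidef hPS
  have htr : MT.trace = M₁.trace + (σ ^ 2)⁻¹ * ∑ t ∈ Finset.Icc 1 (T - 1), z t ⬝ᵥ z t := by
    rw [hMT]; simp [Matrix.trace_sum, Matrix.trace_vecMulVec]
  rw [← htr]
  obtain ⟨htp, h1⟩ := aux_logdet_le hd MT hMTpd
  have h2 := aux_logdet_ge lammin hlam M₁ hM₁pd hev
  have hp := hM₁pd.det_pos
  have h3 := Real.log_le_log (by positivity) hdet
  rw [Real.log_mul (by positivity) hp.ne', Real.log_pow, Nat.cast_sub hη] at h3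
  push_cast at h3
  have hl2 : 0 < Real.log 2 := Real.log_pos (by norm_num)
  rw [← div_div, Real.log_div (by positivity) hlam.ne', div_mul_eq_mul_div, ← sub_le_iff_le_add',
    le_div_iff₀ hl2]
  linarith
end

section
/- Cauchy–Schwarz/Jensen bound for weighted logarithms: Let (Ω, F, P) be a probability space and let X, Y : Ω → R be nonnegative random variables with E[X²] < ∞ and E[Y] < ∞. Then E[ X · log(max(e, Y)) ] ≤ sqrt(E[X²]) · log(e + E[Y]). -/
open MeasureTheory Real

lemma aux_concave : ConcaveOn ℝ (Set.Ici (Real.exp 1)) (fun x : ℝ => Real.log x ^ 2) := by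
  have hpos : ∀ x ∈ Set.Ici (Real.exp 1), x ≠ 0 := fun x hx =>
    (lt_of_lt_of_le (Real.exp_pos 1) hx).ne'
  have hd : ∀ x : ℝ, x ≠ 0 → HasDerivAt (fun x : ℝ => Real.log x ^ 2) (2 * (Real.log x / x)) x := by
    intro x hx
    have := (Real.hasDerivAt_log hx).pow 2
    refine this.congr_deriv ?_
    norm_num
    ring
  apply AntitoneOn.concaveOn_of_deriv (convex_Ici _)
  · exact fun x hx => (hd x (hpos x hx)).continuousAt.continuousWithinAt
  · exact fun x hx => (hd x (hpos x (interior_subset hx))).differentiableAt.differentiableWithinAt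
  · intro x hx y hy hxy
    have hx' := interior_subset hx
    have hy' := interior_subset hy
    rw [(hd x (hpos x hx')).deriv, (hd y (hpos y hy')).deriv]
    have := Real.log_div_self_antitoneOn hx' hy' hxy
    simp only at this
    linarith

/-- Cauchy–Schwarz/Jensen bound for weighted logarithms: for nonnegative random variables
`X, Y` with `E[X²] < ∞` and `E[Y] < ∞`,
`E[X log(max e Y)] ≤ sqrt(E[X²]) · log(e + E[Y])`. -/
theorem cauchy_schwarz_jensen_weighted_log
    {Ω : Type*} [MeasurableSpace Ω] (μ : Measure Ω) [IsProbabilityMeasure μ]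
    (X Y : Ω → ℝ)
    (hXmeas : Measurable X) (hYmeas : Measurable Y)
    (hXnonneg : ∀ ω, 0 ≤ X ω) (hYnonneg : ∀ ω, 0 ≤ Y ω)
    (hX2int : Integrable (fun ω => X ω ^ 2) μ) (hYint : Integrable Y μ) :
    ∫ ω, X ω * Real.log (max (Real.exp 1) (Y ω)) ∂μ
      ≤ Real.sqrt (∫ ω, X ω ^ 2 ∂μ) * Real.log (Real.exp 1 + ∫ ω, Y ω ∂μ) := by
  have he : (0:ℝ) < Real.exp 1 := Real.exp_pos 1
  have hZpos : ∀ ω, 0 < max (Real.exp 1) (Y ω) := fun ω => lt_max_of_lt_left he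
  have hZ1 : ∀ ω, 1 ≤ max (Real.exp 1) (Y ω) := fun ω =>
    le_max_of_le_left (Real.one_le_exp zero_le_one)
  have hLnn : ∀ ω, 0 ≤ Real.log (max (Real.exp 1) (Y ω)) := fun ω => Real.log_nonneg (hZ1 ω)
  have hZint : Integrable (fun ω => max (Real.exp 1) (Y ω)) μ := (integrable_const _).sup hYint
  have hLmeas : Measurable (fun ω => Real.log (max (Real.exp 1) (Y ω))) :=
    Real.measurable_log.comp (measurable_const.max hYmeas)
  have hL2 : Integrable (fun ω => Real.log (max (Real.exp 1) (Y ω)) ^ 2) μ := by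
    refine (hZint.const_mul 4).mono' (hLmeas.pow_const 2).aestronglyMeasurable
      (Filter.Eventually.of_forall fun ω => ?_)
    rw [Real.norm_of_nonneg (sq_nonneg _)]
    have h1 := Real.log_le_sub_one_of_pos (Real.sqrt_pos.2 (hZpos ω))
    rw [Real.log_sqrt (hZpos ω).le] at h1
    have h2 := Real.sq_sqrt (hZpos ω).le
    nlinarith [hLnn ω, Real.sqrt_nonneg (max (Real.exp 1) (Y ω))]
  have hCS := integral_mul_le_Lp_mul_Lq_of_nonneg (μ := μ) Real.HolderConjugate.two_two
    (Filter.Eventually.of_forall hXnonneg) (Filter.Eventually.of_forall hLnn)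
    (by simpa using (memLp_two_iff_integrable_sq hXmeas.aestronglyMeasurable).2 hX2int)
    (by simpa using (memLp_two_iff_integrable_sq hLmeas.aestronglyMeasurable).2 hL2)
  simp only [Real.rpow_two, ← Real.sqrt_eq_rpow] at hCS
  refine hCS.trans (mul_le_mul_of_nonneg_left ?_ (Real.sqrt_nonneg _))
  have hY0 : 0 ≤ ∫ ω, Y ω ∂μ := integral_nonneg hYnonneg
  refine Real.sqrt_le_iff.2 ⟨Real.log_nonneg ?_, ?_⟩
  · linarith [Real.one_le_exp (zero_le_one (α := ℝ))]
  have hJ := aux_concave.le_map_integral (μ := μ) (f := fun ω => max (Real.exp 1) (Y ω))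
    (fun x hx => ((Real.continuousAt_log
      (lt_of_lt_of_le he hx).ne').pow 2).continuousWithinAt) isClosed_Ici
    (Filter.Eventually.of_forall fun ω => Set.mem_Ici.2 (le_max_left _ _)) hZint hL2
  refine hJ.trans ?_
  have hlow : 1 ≤ ∫ ω, max (Real.exp 1) (Y ω) ∂μ := by
    have := integral_mono (integrable_const (1:ℝ)) hZint hZ1
    simpa using this
  have hup : ∫ ω, max (Real.exp 1) (Y ω) ∂μ ≤ Real.exp 1 + ∫ ω, Y ω ∂μ := by
    have := integral_mono hZint ((integrable_const (Real.exp 1)).add hYint)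
      (fun ω => max_le (by simpa using hYnonneg ω) (by simpa using he.le))
    rw [integral_add' (integrable_const _) hYint] at this
    simpa using this
  exact pow_le_pow_left₀ (Real.log_nonneg hlow) (Real.log_le_log (by linarith) hup) 2
end
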